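/- Let R be a commutative ring, x_1, …, x_n ∈ R, and M an R-module. Let Δ(A) be the poset of nonempty subsets σ of {1, …, n}, with x_σ = ∏_{i∈σ} x_i. Then the cohomology of the adelic cochain complex with s-cochains ∏_{σ0 ⊋ σ1 ⊋ ⋯ ⊋ σs, σs ≠ ∅} M[1/x_{σ0}] and the alternating-sum chain-deletion differential is isomorphic to the Čech cohomology Č^*_{(x_1,…,x_n)}(R; M), i.e. to the cohomology of the complex 0 → ⊕_i M[1/x_i] → ⊕_{i<j} M[1/x_i x_j] → ⋯ → M[1/x_1⋯x_n] → 0 placed in degrees 0 through n−1. -/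

import Mathlib

section Machinery

variable {R : Type} [CommRing R] (M : Type) [AddCommGroup M] [Module R M]

/-- If `s ∣ t` and `t ∈ T`, then `s` acts invertibly on the localized module `T⁻¹M`. -/
theorem isUnit_localization_act {T : Submonoid R} {s t : R} (hst : s ∣ t) (ht : t ∈ T) :
    IsUnit ((algebraMap R (Module.End R (LocalizedModule T M))) s) := by
  obtain ⟨c, rfl⟩ := hst
  have hu : IsUnit ((algebraMap R (Module.End R (LocalizedModule T M))) (s * c)) :=
    IsLocalizedModule.map_units (LocalizedModule.mkLinearMap T M) ⟨s * c, ht⟩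
  rw [map_mul] at hu
  have hc : Commute ((algebraMap R (Module.End R (LocalizedModule T M))) s)
      ((algebraMap R (Module.End R (LocalizedModule T M))) c) := by
    rw [Commute, SemiconjBy, ← map_mul, ← map_mul, mul_comm]
  exact (hc.isUnit_mul_iff.mp hu).1

/-- The canonical localization map `M[1/x] → M[1/y]` when `x ∣ y`. -/
noncomputable def locMapOfDvd {x y : R} (h : x ∣ y) :
    LocalizedModule (Submonoid.powers x) M →ₗ[R] LocalizedModule (Submonoid.powers y) M :=
  LocalizedModule.lift _ (LocalizedModule.mkLinearMap (Submonoid.powers y) M)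
    (fun s => by
      obtain ⟨n, hn⟩ := s.2
      exact isUnit_localization_act M (hn ▸ pow_dvd_pow_of_dvd h n)
        (Submonoid.pow_mem _ (Submonoid.mem_powers y) n))

variable {n : ℕ} (x : Fin n → R)

/-- The product `x_σ = ∏_{i ∈ σ} x_i`. -/
def xProd (σ : Finset (Fin n)) : R := ∏ i ∈ σ, x i

/-- The degree `t` term `⊕_{|σ| = t+1} M[1/x_σ]` of the Čech complex. -/
abbrev CechObj (t : ℕ) : Type :=
  ∀ σ : {σ : Finset (Fin n) // σ.card = t + 1},
    LocalizedModule (Submonoid.powers (xProd x σ.1)) M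

/-- The divisibility `x_{σ \ {j}} ∣ x_σ` for `j ∈ σ`. -/
theorem xProd_erase_dvd {σ : Finset (Fin n)} {j : Fin n} (hj : j ∈ σ) :
    xProd x (σ.erase j) ∣ xProd x σ :=
  ⟨x j, (Finset.prod_erase_mul _ _ hj).symm⟩

/-- The differentials of the Čech complex, with the usual signs. -/
noncomputable def cechD (t : ℕ) : CechObj M x t →ₗ[R] CechObj M x (t + 1) :=
  LinearMap.pi fun τ =>
    ∑ j ∈ τ.1.attach,
      ((-1 : ℤ) ^ (τ.1.filter (fun i => i < j.1)).card) •
        ((locMapOfDvd M (xProd_erase_dvd x j.2)) ∘ₗ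
          (LinearMap.proj (⟨τ.1.erase j.1, by
            rw [Finset.card_erase_of_mem j.2, τ.2]; rfl⟩ :
            {σ : Finset (Fin n) // σ.card = t + 1})))

/-- `s`-simplices of the flag complex of the punctured cube `Δ(A)`: strictly
decreasing chains `σ₀ ⊋ σ₁ ⊋ ⋯ ⊋ σₛ` of nonempty subsets of `{1, …, n}`. -/
def PCubeFlag (s : ℕ) : Type :=
  {c : Fin (s + 1) → {σ : Finset (Fin n) // σ.Nonempty} // StrictAnti fun i => (c i).1}

/-- The adelic `s`-cochains: the product over all strictly decreasing chains of
nonempty subsets of `M[1/x_{σ₀}]`. -/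
abbrev PCubeAdelicCochain (s : ℕ) : Type :=
  ∀ c : PCubeFlag (n := n) s, LocalizedModule (Submonoid.powers (xProd x (c.1 0).1)) M

/-- The adelic coboundary: the alternating sum of chain-deletion maps, using the
localization maps `M[1/x_{σ₁}] → M[1/x_{σ₀}]` as needed. -/
noncomputable def pcubeAdelicCoboundary (s : ℕ) :
    PCubeAdelicCochain M x s →ₗ[R] PCubeAdelicCochain M x (s + 1) :=
  LinearMap.pi fun c =>
    ∑ i : Fin (s + 2),
      ((-1 : ℤ) ^ (i : ℕ)) •
        ((locMapOfDvd M (Finset.prod_dvd_prod_of_subset _ _ _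
            (c.2.antitone (Fin.zero_le _) : (c.1 (Fin.succAbove i 0)).1 ≤ (c.1 0).1))) ∘ₗ
          LinearMap.proj
            (⟨fun j => c.1 (Fin.succAbove i j),
              c.2.comp_strictMono (Fin.strictMono_succAbove i)⟩ : PCubeFlag s))

end Machinery

section ConicalComplex

open Finsupp

/-- An augmented complex of free abelian groups whose basis elements are labelled by elements of
`P`, such that for every `σ ≠ ⊥` the subcomplex spanned by the labels `≤ σ` is contracted by
`cone σ`. The degree `0` part is the augmentation. -/
structure ConicalComplex (P : Type) [PartialOrder P] [OrderBot P] where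
  /-- The basis in each degree. -/
  X : ℕ → Type
  /-- The label of a basis element. -/
  label : ∀ {s}, X s → P
  /-- The generator of the augmentation. -/
  pt : X 0
  eq_pt : ∀ a : X 0, a = pt
  label_pt : label pt = ⊥
  label_ne_bot : ∀ {s} (a : X (s + 1)), label a ≠ ⊥
  /-- The differential. -/
  d : ∀ s, (X (s + 1) →₀ ℤ) →ₗ[ℤ] (X s →₀ ℤ)
  /-- The contraction of the part of label at most `σ`. -/
  cone : P → ∀ s, (X s →₀ ℤ) →ₗ[ℤ] (X (s + 1) →₀ ℤ)
  d_single_mem : ∀ {s} (a : X (s + 1)), d s (single a 1) ∈ supported ℤ ℤ {b | label b ≤ label a}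
  cone_single_mem : ∀ {σ s} (a : X s), σ ≠ ⊥ → label a ≤ σ →
    cone σ s (single a 1) ∈ supported ℤ ℤ {b | label b ≤ σ}
  d_cone_pt : ∀ {σ}, σ ≠ ⊥ → d 0 (cone σ 0 (single pt 1)) = single pt 1
  d_cone_single : ∀ {σ s} (a : X (s + 1)), label a ≤ σ →
    d (s + 1) (cone σ (s + 1) (single a 1)) + cone σ s (d s (single a 1)) = single a 1
  cone_label_self : ∀ {s} (a : X (s + 1)), cone (label a) (s + 1) (single a 1) = 0

/-- Two linear maps agreeing on the basis elements in a set agree on the chains supported there. -/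
theorem Finsupp.map_eq_of_mem_supported {X N : Type} [AddCommGroup N] {S : Set X}
    {f g : (X →₀ ℤ) →ₗ[ℤ] N} (h : ∀ a ∈ S, f (single a 1) = g (single a 1))
    {z : X →₀ ℤ} (hz : z ∈ supported ℤ ℤ S) : f z = g z := by
  rw [supported_eq_span_single] at hz
  refine LinearMap.eqOn_span (f := f) (g := g) ?_ hz
  rintro _ ⟨a, ha, rfl⟩
  exact h a ha

/-- A linear map carrying the basis elements in `S` into `p` carries all chains supported in `S`
into `p`. -/
theorem Finsupp.map_mem_of_mem_supported {X N : Type} [AddCommGroup N] {S : Set X}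
    {f : (X →₀ ℤ) →ₗ[ℤ] N} {p : Submodule ℤ N} (h : ∀ a ∈ S, f (single a 1) ∈ p)
    {z : X →₀ ℤ} (hz : z ∈ supported ℤ ℤ S) : f z ∈ p := by
  rw [supported_eq_span_single] at hz
  have : Submodule.span ℤ ((fun i => single i (1 : ℤ)) '' S) ≤ p.comap f := by
    rw [Submodule.span_le]
    rintro _ ⟨a, ha, rfl⟩
    exact h a ha
  exact this hz

variable {P : Type} [PartialOrder P]

/-- A map of free abelian groups on labelled bases is carried if it does not increase labels. -/
def IsCarried {X Y : Type} (p : X → P) (q : Y → P) (φ : (X →₀ ℤ) →ₗ[ℤ] (Y →₀ ℤ)) : Prop :=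
  ∀ a, φ (single a 1) ∈ supported ℤ ℤ {b | q b ≤ p a}

theorem IsCarried.map_mem {X Y : Type} {p : X → P} {q : Y → P}
    {φ : (X →₀ ℤ) →ₗ[ℤ] (Y →₀ ℤ)} (hφ : IsCarried p q φ) {σ : P} {z : X →₀ ℤ}
    (hz : z ∈ supported ℤ ℤ {a | p a ≤ σ}) : φ z ∈ supported ℤ ℤ {b | q b ≤ σ} :=
  map_mem_of_mem_supported (S := {a | p a ≤ σ})
    (fun a ha => supported_mono (fun _ hb => le_trans hb ha) (hφ a)) hz

theorem IsCarried.comp {X Y Z : Type} {p : X → P} {q : Y → P} {r : Z → P}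
    {ψ : (Y →₀ ℤ) →ₗ[ℤ] (Z →₀ ℤ)} {φ : (X →₀ ℤ) →ₗ[ℤ] (Y →₀ ℤ)}
    (hψ : IsCarried q r ψ) (hφ : IsCarried p q φ) : IsCarried p r (ψ ∘ₗ φ) :=
  fun a => hψ.map_mem (hφ a)

namespace ConicalComplex

variable [OrderBot P] (A B : ConicalComplex P)

theorem isCarried_d (s : ℕ) : IsCarried A.label A.label (A.d s) := A.d_single_mem

theorem cone_mem {σ : P} (hσ : σ ≠ ⊥) {s : ℕ} {z : A.X s →₀ ℤ}
    (hz : z ∈ supported ℤ ℤ {a | A.label a ≤ σ}) :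
    A.cone σ s z ∈ supported ℤ ℤ {a | A.label a ≤ σ} :=
  map_mem_of_mem_supported (fun a ha => A.cone_single_mem a hσ ha) hz

theorem d_cone_zero {σ : P} (hσ : σ ≠ ⊥) (z : A.X 0 →₀ ℤ) : A.d 0 (A.cone σ 0 z) = z := by
  have : A.d 0 ∘ₗ A.cone σ 0 = LinearMap.id := by
    ext a : 2
    rw [A.eq_pt a]
    exact A.d_cone_pt hσ
  exact LinearMap.congr_fun this z

theorem d_cone_succ {σ : P} {s : ℕ} {z : A.X (s + 1) →₀ ℤ}
    (hz : z ∈ supported ℤ ℤ {a | A.label a ≤ σ}) :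
    A.d (s + 1) (A.cone σ (s + 1) z) = z - A.cone σ s (A.d s z) := by
  rw [eq_sub_iff_add_eq]
  exact map_eq_of_mem_supported
    (f := A.d (s + 1) ∘ₗ A.cone σ (s + 1) + A.cone σ s ∘ₗ A.d s) (g := LinearMap.id)
    (fun a ha => A.d_cone_single a ha) hz

theorem d_d (s : ℕ) (z : A.X (s + 2) →₀ ℤ) : A.d s (A.d (s + 1) z) = 0 := by
  suffices A.d s ∘ₗ A.d (s + 1) = 0 from LinearMap.congr_fun this z
  clear z
  induction s with
  | zero =>
    ext a : 2
    have h := A.d_cone_single a le_rfl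
    rw [A.cone_label_self, map_zero, zero_add] at h
    change A.d 0 (A.d 1 (single a 1)) = 0
    rw [← h, A.d_cone_succ (A.d_single_mem a), map_sub,
      A.d_cone_zero (A.label_ne_bot a), sub_self]
  | succ s ih =>
    ext a : 2
    have h := A.d_cone_single a le_rfl
    rw [A.cone_label_self, map_zero, zero_add] at h
    change A.d (s + 1) (A.d (s + 2) (single a 1)) = 0
    have h0 : A.d s (A.d (s + 1) (A.d (s + 2) (single a 1))) = 0 :=
      LinearMap.congr_fun ih _
    rw [← h, A.d_cone_succ (A.d_single_mem a), map_sub,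
      A.d_cone_succ ((A.isCarried_d _).map_mem (A.d_single_mem a)), h0, map_zero, sub_zero,
      sub_self]

/-- The comparison map between two conical complexes. -/
noncomputable def comparison : ∀ s, (A.X s →₀ ℤ) →ₗ[ℤ] (B.X s →₀ ℤ)
  | 0 => linearCombination ℤ fun _ => single B.pt 1
  | s + 1 => linearCombination ℤ fun a =>
      B.cone (A.label a) s (comparison s (A.d s (single a 1)))

theorem comparison_succ_single {s : ℕ} (a : A.X (s + 1)) :
    comparison A B (s + 1) (single a 1) =
      B.cone (A.label a) s (comparison A B s (A.d s (single a 1))) := by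
  rw [comparison, linearCombination_single, one_smul]

theorem comparison_zero_comp : comparison B A 0 ∘ₗ comparison A B 0 = LinearMap.id := by
  ext a : 2
  simp [comparison, A.eq_pt a]

theorem isCarried_comparison (s : ℕ) : IsCarried A.label B.label (comparison A B s) := by
  induction s with
  | zero =>
    intro a
    simp [comparison, single_mem_supported, B.label_pt]
  | succ s ih =>
    intro a
    rw [comparison_succ_single]
    exact B.cone_mem (A.label_ne_bot a) (ih.map_mem (A.d_single_mem a))

theorem d_comp_comparison (s : ℕ) :
    B.d s ∘ₗ comparison A B (s + 1) = comparison A B s ∘ₗ A.d s := by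
  induction s with
  | zero =>
    ext a : 2
    simp only [LinearMap.comp_apply, lsingle_apply]
    rw [comparison_succ_single, B.d_cone_zero (A.label_ne_bot a)]
  | succ s ih =>
    ext a : 2
    have h : B.d s (comparison A B (s + 1) (A.d (s + 1) (single a 1))) = 0 :=
      (LinearMap.congr_fun ih _).trans (by simp only [LinearMap.comp_apply, d_d, map_zero])
    simp only [LinearMap.comp_apply, lsingle_apply]
    rw [comparison_succ_single,
      B.d_cone_succ ((isCarried_comparison A B _).map_mem (A.d_single_mem a)), h, map_zero,
      sub_zero]

/-- The homotopy from the identity to an endomorphism `θ` of a conical complex. -/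
noncomputable def homotopy (θ : ∀ s, (A.X s →₀ ℤ) →ₗ[ℤ] (A.X s →₀ ℤ)) :
    ∀ s, (A.X s →₀ ℤ) →ₗ[ℤ] (A.X (s + 1) →₀ ℤ)
  | 0 => 0
  | s + 1 => linearCombination ℤ fun a => A.cone (A.label a) (s + 1)
      (θ (s + 1) (single a 1) - single a 1 - homotopy θ s (A.d s (single a 1)))

variable {A} {θ : ∀ s, (A.X s →₀ ℤ) →ₗ[ℤ] (A.X s →₀ ℤ)}
  (hθ : ∀ s, IsCarried A.label A.label (θ s)) (h_zero : θ 0 = LinearMap.id)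
  (hd : ∀ s, A.d s ∘ₗ θ (s + 1) = θ s ∘ₗ A.d s)

include hθ in
theorem isCarried_homotopy (s : ℕ) : IsCarried A.label A.label (A.homotopy θ s) := by
  induction s with
  | zero => exact fun a => Submodule.zero_mem _
  | succ s ih =>
    intro a
    rw [homotopy, linearCombination_single, one_smul]
    exact A.cone_mem (A.label_ne_bot a) (Submodule.sub_mem _ (Submodule.sub_mem _ (hθ _ a)
      (single_mem_supported ℤ _ le_rfl)) (ih.map_mem (A.d_single_mem a)))

include hθ h_zero hd in
theorem homotopy_spec (s : ℕ) :
    A.d (s + 1) ∘ₗ A.homotopy θ (s + 1) + A.homotopy θ s ∘ₗ A.d s =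
      θ (s + 1) - LinearMap.id := by
  have key (s : ℕ) (a : A.X (s + 1)) (h : A.d s (θ (s + 1) (single a 1) - single a 1 -
      A.homotopy θ s (A.d s (single a 1))) = 0) :
      A.d (s + 1) (A.homotopy θ (s + 1) (single a 1)) +
        A.homotopy θ s (A.d s (single a 1)) = θ (s + 1) (single a 1) - single a 1 := by
    rw [homotopy, linearCombination_single, one_smul, A.d_cone_succ, h, map_zero, sub_zero,
      sub_add_cancel]
    exact Submodule.sub_mem _ (Submodule.sub_mem _ (hθ _ a)
      (single_mem_supported ℤ _ le_rfl)) ((isCarried_homotopy hθ s).map_mem (A.d_single_mem a))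
  have comm (s : ℕ) (z : A.X (s + 1) →₀ ℤ) : A.d s (θ (s + 1) z) = θ s (A.d s z) :=
    LinearMap.congr_fun (hd s) z
  induction s with
  | zero =>
    ext a : 2
    refine key 0 a ?_
    simp [comm, h_zero, homotopy]
  | succ s ih =>
    ext a : 2
    refine key (s + 1) a ?_
    have h := LinearMap.congr_fun ih (A.d (s + 1) (single a 1))
    simp only [LinearMap.add_apply, LinearMap.comp_apply, LinearMap.sub_apply, d_d, map_zero,
      add_zero, LinearMap.id_apply] at h
    rw [map_sub, map_sub, h, comm, sub_self]

end ConicalComplex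

end ConicalComplex

section Cochains

open Finsupp

variable {P : Type} [PartialOrder P] {R : Type} [CommRing R] {F : P → Type}
  [∀ a, AddCommGroup (F a)] [∀ a, Module R (F a)]
  (L : ∀ ⦃a b : P⦄, a ≤ b → F a →ₗ[R] F b)

open Classical in
/-- The value at level `σ` of a chain on a cochain, where the basis elements whose label is not at
most `σ` are discarded. -/
noncomputable def evalChain {X : Type} (p : X → P) (σ : P) (f : ∀ a, F (p a)) :
    (X →₀ ℤ) →ₗ[ℤ] F σ :=
  linearCombination ℤ fun a => if h : p a ≤ σ then L h (f a) else 0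

theorem evalChain_single {X : Type} (p : X → P) {σ : P} (f : ∀ a, F (p a)) {a : X}
    (h : p a ≤ σ) : evalChain L p σ f (single a 1) = L h (f a) := by
  rw [evalChain, linearCombination_single, one_smul, dif_pos h]

/-- The map on cochains induced by a map on chains. -/
noncomputable def pullback {X Y : Type} (p : X → P) (q : Y → P)
    (φ : (X →₀ ℤ) →ₗ[ℤ] (Y →₀ ℤ)) : (∀ b, F (q b)) →ₗ[R] (∀ a, F (p a)) where
  toFun f a := evalChain L q (p a) f (φ (single a 1))
  map_add' f g := by
    ext a
    simp only [evalChain, linearCombination_apply, Pi.add_apply, ← Finsupp.sum_add, ← smul_add]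
    congr! 3
    split_ifs <;> simp
  map_smul' r f := by
    ext a
    simp only [evalChain, linearCombination_apply, Pi.smul_apply, Finsupp.smul_sum,
      RingHom.id_apply]
    congr! 2
    split_ifs
    · simp only [map_smul, smul_comm _ r]
    · simp only [smul_zero]

variable {X Y Z : Type} {p : X → P} {q : Y → P} {r : Z → P}

theorem pullback_apply (φ : (X →₀ ℤ) →ₗ[ℤ] (Y →₀ ℤ)) (f : ∀ b, F (q b)) (a : X) :
    pullback L p q φ f a = evalChain L q (p a) f (φ (single a 1)) := rfl

theorem pullback_add (φ ψ : (X →₀ ℤ) →ₗ[ℤ] (Y →₀ ℤ)) :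
    pullback L p q (φ + ψ) = pullback L p q φ + pullback L p q ψ := by
  ext f a
  simp [pullback_apply]

theorem pullback_sub (φ ψ : (X →₀ ℤ) →ₗ[ℤ] (Y →₀ ℤ)) :
    pullback L p q (φ - ψ) = pullback L p q φ - pullback L p q ψ := by
  ext f a
  simp [pullback_apply]

theorem pullback_zero : pullback L p q 0 = 0 := by
  ext f a
  simp [pullback_apply]

variable (hid : ∀ a : P, L (le_refl a) = LinearMap.id)
  (hcomp : ∀ ⦃a b c : P⦄ (hab : a ≤ b) (hbc : b ≤ c), L hbc ∘ₗ L hab = L (hab.trans hbc))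

include hid in
theorem pullback_id : pullback L p p LinearMap.id = LinearMap.id := by
  ext f a
  rw [pullback_apply, LinearMap.id_apply, evalChain_single L p f le_rfl, hid]
  rfl

include hcomp in
theorem map_evalChain {σ τ : P} (h : σ ≤ τ) (f : ∀ b, F (q b)) {z : Y →₀ ℤ}
    (hz : z ∈ supported ℤ ℤ {b | q b ≤ σ}) :
    L h (evalChain L q σ f z) = evalChain L q τ f z := by
  refine map_eq_of_mem_supported
    (f := (L h).toAddMonoidHom.toIntLinearMap ∘ₗ evalChain L q σ f) (fun b hb => ?_) hz
  have hb : q b ≤ σ := hb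
  rw [LinearMap.comp_apply, evalChain_single L q f hb, evalChain_single L q f (hb.trans h),
    ← hcomp hb h]
  rfl

include hcomp in
theorem pullback_comp {ψ : (Y →₀ ℤ) →ₗ[ℤ] (Z →₀ ℤ)} {φ : (X →₀ ℤ) →ₗ[ℤ] (Y →₀ ℤ)}
    (hψ : IsCarried q r ψ) (hφ : IsCarried p q φ) :
    pullback L p r (ψ ∘ₗ φ) = pullback L p q φ ∘ₗ pullback L q r ψ := by
  ext f a
  refine (map_eq_of_mem_supported (f := evalChain L q (p a) (pullback L q r ψ f))
    (g := evalChain L r (p a) f ∘ₗ ψ) (fun b hb => ?_) (hφ a)).symm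
  rw [evalChain_single L q _ hb, pullback_apply, map_evalChain L hcomp _ _ (hψ b)]
  rfl

end Cochains

section Homology

variable {R : Type*} [Ring R] {U₀ U₁ U₂ V₀ V₁ V₂ : Type*}
  [AddCommGroup U₀] [AddCommGroup U₁] [AddCommGroup U₂]
  [AddCommGroup V₀] [AddCommGroup V₁] [AddCommGroup V₂]
  [Module R U₀] [Module R U₁] [Module R U₂] [Module R V₀] [Module R V₁] [Module R V₂]

/-- Maps that are mutually inverse on cycles up to boundaries induce an isomorphism on homology. -/
theorem nonempty_homology_equiv {c : U₀ →ₗ[R] U₁} {d : U₁ →ₗ[R] U₂}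
    {c' : V₀ →ₗ[R] V₁} {d' : V₁ →ₗ[R] V₂} (f : U₁ →ₗ[R] V₁) (g : V₁ →ₗ[R] U₁)
    (hf : ∀ u ∈ d.ker, f u ∈ d'.ker) (hg : ∀ v ∈ d'.ker, g v ∈ d.ker)
    (hfc : ∀ u ∈ c.range, f u ∈ c'.range) (hgc : ∀ v ∈ c'.range, g v ∈ c.range)
    (hgf : ∀ u ∈ d.ker, g (f u) - u ∈ c.range) (hfg : ∀ v ∈ d'.ker, f (g v) - v ∈ c'.range) :
    Nonempty ((d.ker ⧸ Submodule.comap d.ker.subtype c.range) ≃ₗ[R]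
      (d'.ker ⧸ Submodule.comap d'.ker.subtype c'.range)) := by
  refine ⟨LinearEquiv.ofLinearMap
    (Submodule.mapQ _ _ (f.restrict hf) fun u hu => hfc _ hu)
    (Submodule.mapQ _ _ (g.restrict hg) fun v hv => hgc _ hv) ?_ ?_⟩
  · ext v
    exact (Submodule.Quotient.eq _).2 (hfg v.1 v.2)
  · ext u
    exact (Submodule.Quotient.eq _).2 (hgf u.1 u.2)

/-- Maps that are mutually inverse on kernels induce an isomorphism of kernels. -/
theorem nonempty_ker_equiv {d : U₁ →ₗ[R] U₂} {d' : V₁ →ₗ[R] V₂} (f : U₁ →ₗ[R] V₁)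
    (g : V₁ →ₗ[R] U₁) (hf : ∀ u ∈ d.ker, f u ∈ d'.ker) (hg : ∀ v ∈ d'.ker, g v ∈ d.ker)
    (hgf : ∀ u ∈ d.ker, g (f u) = u) (hfg : ∀ v ∈ d'.ker, f (g v) = v) :
    Nonempty (d.ker ≃ₗ[R] d'.ker) :=
  ⟨LinearEquiv.ofLinearMap (f.restrict hf) (g.restrict hg)
    (LinearMap.ext fun v => Subtype.ext (hfg v.1 v.2))
    (LinearMap.ext fun u => Subtype.ext (hgf u.1 u.2))⟩

end Homology

namespace ConicalComplex

variable {P : Type} [PartialOrder P] [OrderBot P] {R : Type} [CommRing R] {F : P → Type}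
  [∀ a, AddCommGroup (F a)] [∀ a, Module R (F a)]
  (L : ∀ ⦃a b : P⦄, a ≤ b → F a →ₗ[R] F b)

/-- The coboundary of the cochain complex of a conical complex with coefficients in `F`, with the
augmentation removed. -/
noncomputable def coboundary (A : ConicalComplex P) (s : ℕ) :
    (∀ a : A.X (s + 1), F (A.label a)) →ₗ[R] (∀ a : A.X (s + 2), F (A.label a)) :=
  pullback L A.label A.label (A.d (s + 1))

/-- The map on cochains induced by the comparison map. -/
noncomputable def comparisonPullback (A B : ConicalComplex P) (s : ℕ) :
    (∀ b : B.X (s + 1), F (B.label b)) →ₗ[R] (∀ a : A.X (s + 1), F (A.label a)) :=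
  pullback L A.label B.label (comparison A B (s + 1))

variable (hid : ∀ a : P, L (le_refl a) = LinearMap.id)
  (hcomp : ∀ ⦃a b c : P⦄ (hab : a ≤ b) (hbc : b ≤ c), L hbc ∘ₗ L hab = L (hab.trans hbc))

include hcomp in
theorem coboundary_comparisonPullback (A B : ConicalComplex P) (s : ℕ)
    (f : ∀ b : B.X (s + 1), F (B.label b)) :
    coboundary L A s (comparisonPullback L A B s f) =
      comparisonPullback L A B (s + 1) (coboundary L B s f) := by
  have h := congrArg (pullback L A.label B.label) (d_comp_comparison A B (s + 1))
  rw [pullback_comp L hcomp (B.isCarried_d _) (isCarried_comparison A B _),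
    pullback_comp L hcomp (isCarried_comparison A B _) (A.isCarried_d _)] at h
  exact (LinearMap.congr_fun h f).symm

include hid hcomp in
theorem comparisonPullback_comparisonPullback (A B : ConicalComplex P) (s : ℕ) :
    ∃ (h : (∀ a : A.X (s + 1), F (A.label a)) →ₗ[R] (∀ a : A.X s, F (A.label a)))
      (h' : (∀ a : A.X (s + 2), F (A.label a)) →ₗ[R] (∀ a : A.X (s + 1), F (A.label a))),
      (s = 0 → h = 0) ∧ ∀ f,
        comparisonPullback L A B s (comparisonPullback L B A s f) - f =
          h' (coboundary L A s f) + pullback L A.label A.label (A.d s) (h f) := by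
  let θ (s : ℕ) := comparison B A s ∘ₗ comparison A B s
  have hθ (s : ℕ) : IsCarried A.label A.label (θ s) :=
    (isCarried_comparison B A s).comp (isCarried_comparison A B s)
  have hd (s : ℕ) : A.d s ∘ₗ θ (s + 1) = θ s ∘ₗ A.d s := by
    rw [← LinearMap.comp_assoc, d_comp_comparison, LinearMap.comp_assoc, d_comp_comparison,
      LinearMap.comp_assoc]
  refine ⟨pullback L A.label A.label (A.homotopy θ s),
    pullback L A.label A.label (A.homotopy θ (s + 1)), ?_, fun f => ?_⟩
  · rintro rfl
    exact pullback_zero L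
  · have h := congrArg (pullback L A.label A.label)
      (homotopy_spec hθ (comparison_zero_comp A B) hd s)
    rw [pullback_sub, pullback_id L hid, pullback_add,
      pullback_comp L hcomp (A.isCarried_d _) (isCarried_homotopy hθ _),
      pullback_comp L hcomp (isCarried_homotopy hθ _) (A.isCarried_d _),
      pullback_comp L hcomp (isCarried_comparison B A _) (isCarried_comparison A B _)] at h
    exact (LinearMap.congr_fun h f).symm

include hcomp in
theorem comparisonPullback_mem_ker (A B : ConicalComplex P) (s : ℕ)
    (f : ∀ b : B.X (s + 1), F (B.label b)) (hf : f ∈ (coboundary L B s).ker) :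
    comparisonPullback L A B s f ∈ (coboundary L A s).ker := by
  rw [LinearMap.mem_ker] at hf ⊢
  rw [coboundary_comparisonPullback L hcomp, hf, map_zero]

include hcomp in
theorem comparisonPullback_mem_range (A B : ConicalComplex P) (s : ℕ)
    (f : ∀ b : B.X (s + 2), F (B.label b)) (hf : f ∈ (coboundary L B s).range) :
    comparisonPullback L A B (s + 1) f ∈ (coboundary L A s).range := by
  obtain ⟨g, rfl⟩ := hf
  exact ⟨_, coboundary_comparisonPullback L hcomp A B s g⟩

include hid hcomp in
theorem comparisonPullback_sub_mem_range (A B : ConicalComplex P) (s : ℕ)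
    (f : ∀ a : A.X (s + 2), F (A.label a)) (hf : f ∈ (coboundary L A (s + 1)).ker) :
    comparisonPullback L A B (s + 1) (comparisonPullback L B A (s + 1) f) - f ∈
      (coboundary L A s).range := by
  obtain ⟨h, h', -, H⟩ := comparisonPullback_comparisonPullback L hid hcomp A B (s + 1)
  rw [H, LinearMap.mem_ker.1 hf, map_zero, zero_add]
  exact ⟨_, rfl⟩

include hid hcomp in
theorem comparisonPullback_comparisonPullback_zero (A B : ConicalComplex P)
    (f : ∀ a : A.X 1, F (A.label a)) (hf : f ∈ (coboundary L A 0).ker) :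
    comparisonPullback L A B 0 (comparisonPullback L B A 0 f) = f := by
  obtain ⟨h, h', h0, H⟩ := comparisonPullback_comparisonPullback L hid hcomp A B 0
  rw [← sub_eq_zero, H, LinearMap.mem_ker.1 hf, h0 rfl]
  simp

include hid hcomp in
/-- Any two conical complexes have isomorphic cohomology with coefficients in any functor. -/
theorem nonempty_cohomology_equiv (A B : ConicalComplex P)
    {δA : ∀ s, (∀ a : A.X (s + 1), F (A.label a)) →ₗ[R] (∀ a : A.X (s + 2), F (A.label a))}
    {δB : ∀ s, (∀ b : B.X (s + 1), F (B.label b)) →ₗ[R] (∀ b : B.X (s + 2), F (B.label b))}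
    (hA : coboundary L A = δA) (hB : coboundary L B = δB) :
    Nonempty ((δA 0).ker ≃ₗ[R] (δB 0).ker) ∧
    ∀ s : ℕ, Nonempty
      (((δA (s + 1)).ker ⧸ Submodule.comap (δA (s + 1)).ker.subtype (δA s).range) ≃ₗ[R]
        ((δB (s + 1)).ker ⧸ Submodule.comap (δB (s + 1)).ker.subtype (δB s).range)) := by
  subst hA hB
  exact
  ⟨nonempty_ker_equiv (comparisonPullback L B A 0) (comparisonPullback L A B 0)
    (comparisonPullback_mem_ker L hcomp B A 0) (comparisonPullback_mem_ker L hcomp A B 0)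
    (comparisonPullback_comparisonPullback_zero L hid hcomp A B)
    (comparisonPullback_comparisonPullback_zero L hid hcomp B A),
  fun s => nonempty_homology_equiv (comparisonPullback L B A (s + 1))
    (comparisonPullback L A B (s + 1))
    (comparisonPullback_mem_ker L hcomp B A _) (comparisonPullback_mem_ker L hcomp A B _)
    (comparisonPullback_mem_range L hcomp B A s) (comparisonPullback_mem_range L hcomp A B s)
    (comparisonPullback_sub_mem_range L hid hcomp A B s)
    (comparisonPullback_sub_mem_range L hid hcomp B A s)⟩

end ConicalComplex

section PuncturedCube

open Finsupp

variable {n : ℕ}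

/-- Strictly decreasing chains of `s` nonempty subsets of `{1, …, n}`. -/
abbrev DecChain (n s : ℕ) : Type :=
  {c : Fin s → {σ : Finset (Fin n) // σ.Nonempty} // StrictAnti fun i => (c i).1}

namespace DecChain

/-- The largest member of a chain, or `∅` if the chain is empty. -/
def top : ∀ {s}, DecChain n s → Finset (Fin n)
  | 0, _ => ∅
  | _ + 1, c => (c.1 0).1

/-- Deletion of the `i`-th member of a chain. -/
def face {s : ℕ} (c : DecChain n (s + 1)) (i : Fin (s + 1)) : DecChain n s :=
  ⟨fun j => c.1 (Fin.succAbove i j), c.2.comp_strictMono (Fin.strictMono_succAbove i)⟩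

theorem le_top {s : ℕ} (c : DecChain n s) (i : Fin s) : (c.1 i).1 ≤ top c := by
  cases s with
  | zero => exact i.elim0
  | succ s => exact c.2.antitone (Fin.zero_le i)

theorem top_face_le {s : ℕ} (c : DecChain n (s + 1)) (i : Fin (s + 1)) :
    top (face c i) ≤ top c := by
  cases s with
  | zero => exact Finset.empty_subset _
  | succ s => exact c.le_top _

theorem top_face_zero_lt {s : ℕ} (c : DecChain n (s + 1)) : top (face c 0) < top c := by
  cases s with
  | zero => exact Finset.empty_ssubset.2 (c.1 0).2
  | succ s => exact c.2 (Fin.succ_pos 0)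

theorem top_face_succ {s : ℕ} (c : DecChain n (s + 1)) (i : Fin s) :
    top (face c i.succ) = top c := by
  cases s with
  | zero => exact i.elim0
  | succ s => exact congrArg (fun j => (c.1 j).1) (Fin.succ_succAbove_zero i)

/-- Adding a new largest member to a chain. -/
def cons {s : ℕ} (σ : {σ : Finset (Fin n) // σ.Nonempty}) (c : DecChain n s)
    (h : top c < σ.1) : DecChain n (s + 1) :=
  ⟨Fin.cons σ c.1, by
    intro i j hij
    induction j using Fin.cases with
    | zero => exact absurd hij (Fin.not_lt_zero i)
    | succ j =>
      induction i using Fin.cases with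
      | zero => simpa using (c.le_top j).trans_lt h
      | succ i => simpa using c.2 (Fin.succ_lt_succ_iff.1 hij)⟩

theorem face_cons_zero {s : ℕ} (σ : {σ : Finset (Fin n) // σ.Nonempty}) (c : DecChain n s)
    (h : top c < σ.1) : face (cons σ c h) 0 = c := by
  ext j : 2
  simp [face, cons]

theorem face_cons_succ {s : ℕ} (σ : {σ : Finset (Fin n) // σ.Nonempty}) (c : DecChain n (s + 1))
    (h : top c < σ.1) (i : Fin (s + 1)) :
    face (cons σ c h) i.succ = cons σ (face c i) ((c.top_face_le i).trans_lt h) := by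
  ext j : 2
  induction j using Fin.cases <;> simp [face, cons]

theorem cons_face_zero {s : ℕ} (c : DecChain n (s + 1)) :
    cons (c.1 0) (face c 0) c.top_face_zero_lt = c := by
  ext j : 2
  induction j using Fin.cases <;> simp [face, cons]

/-- The simplicial boundary of a chain. -/
noncomputable def boundary (s : ℕ) : (DecChain n (s + 1) →₀ ℤ) →ₗ[ℤ] (DecChain n s →₀ ℤ) :=
  linearCombination ℤ fun c => ∑ i : Fin (s + 1), (-1 : ℤ) ^ (i : ℕ) • single (face c i) 1

theorem boundary_single {s : ℕ} (c : DecChain n (s + 1)) :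
    boundary s (single c 1) = ∑ i : Fin (s + 1), (-1 : ℤ) ^ (i : ℕ) • single (face c i) 1 := by
  rw [boundary, linearCombination_single, one_smul]

open Classical in
/-- The cone with apex `σ`. -/
noncomputable def cone (σ : Finset (Fin n)) (s : ℕ) :
    (DecChain n s →₀ ℤ) →ₗ[ℤ] (DecChain n (s + 1) →₀ ℤ) :=
  linearCombination ℤ fun c =>
    if h : σ.Nonempty ∧ top c < σ then single (cons ⟨σ, h.1⟩ c h.2) 1 else 0

theorem cone_single_of_lt {σ : Finset (Fin n)} {s : ℕ} {c : DecChain n s} (hσ : σ.Nonempty)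
    (h : top c < σ) : cone σ s (single c 1) = single (cons ⟨σ, hσ⟩ c h) 1 := by
  rw [cone, linearCombination_single, one_smul, dif_pos ⟨hσ, h⟩]

theorem cone_single_of_not_lt {σ : Finset (Fin n)} {s : ℕ} {c : DecChain n s}
    (h : ¬ top c < σ) : cone σ s (single c 1) = 0 := by
  rw [cone, linearCombination_single, one_smul, dif_neg fun h' => h h'.2]

theorem boundary_cone_single {σ : Finset (Fin n)} {s : ℕ} (c : DecChain n (s + 1))
    (h : top c ≤ σ) :
    boundary (s + 1) (cone σ (s + 1) (single c 1)) + cone σ s (boundary s (single c 1)) =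
      single c 1 := by
  obtain rfl | hlt := h.eq_or_lt
  · rw [cone_single_of_not_lt (lt_irrefl _), map_zero, zero_add, boundary_single, map_sum,
      Fin.sum_univ_succ, Finset.sum_eq_zero, add_zero]
    · rw [map_smul, Fin.val_zero, pow_zero, one_smul]
      exact (cone_single_of_lt (c.1 0).2 c.top_face_zero_lt).trans
        (congrArg (single · 1) c.cons_face_zero)
    · intro i _
      rw [map_smul, cone_single_of_not_lt (by rw [top_face_succ]; exact lt_irrefl _), smul_zero]
  · have hσ : σ.Nonempty := (c.1 0).2.mono h
    rw [cone_single_of_lt hσ hlt, boundary_single, boundary_single, map_sum, Fin.sum_univ_succ,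
      face_cons_zero, add_assoc, ← Finset.sum_add_distrib, Finset.sum_eq_zero]
    · simp
    · intro i _
      rw [map_smul, cone_single_of_lt hσ ((c.top_face_le i).trans_lt hlt), face_cons_succ,
        Fin.val_succ, pow_succ, ← add_smul]
      simp

end DecChain

/-- The augmented chain complex of the flag complex of the punctured cube. -/
noncomputable def flagComplex (n : ℕ) : ConicalComplex (Finset (Fin n)) where
  X := DecChain n
  label := DecChain.top
  pt := ⟨Fin.elim0, fun i => i.elim0⟩
  eq_pt _ := Subtype.ext (Subsingleton.elim _ _)
  label_pt := rfl
  label_ne_bot c := (c.1 0).2.ne_empty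
  d := DecChain.boundary
  cone := DecChain.cone
  d_single_mem c := by
    rw [DecChain.boundary_single]
    exact Submodule.sum_mem _ fun i _ =>
      Submodule.smul_mem _ _ (single_mem_supported ℤ _ (c.top_face_le i))
  cone_single_mem {σ s} c hσ _ := by
    by_cases h : c.top < σ
    · rw [DecChain.cone_single_of_lt (Finset.nonempty_iff_ne_empty.2 hσ) h]
      exact single_mem_supported ℤ _ (le_refl σ)
    · rw [DecChain.cone_single_of_not_lt h]
      exact Submodule.zero_mem _
  d_cone_pt {σ} hσ := by
    have hσ := Finset.nonempty_iff_ne_empty.2 hσ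
    rw [DecChain.cone_single_of_lt (c := ⟨Fin.elim0, fun i => i.elim0⟩) hσ
      (Finset.empty_ssubset.2 hσ), DecChain.boundary_single, Fin.sum_univ_one, Fin.val_zero,
      pow_zero, one_smul]
    exact congrArg (single · 1) (DecChain.face_cons_zero _ _ _)
  d_cone_single c h := c.boundary_cone_single h
  cone_label_self c := DecChain.cone_single_of_not_lt (lt_irrefl _)

/-- The subsets of `{1, …, n}` with `t` elements. -/
abbrev CardSubset (n t : ℕ) : Type := {σ : Finset (Fin n) // σ.card = t}

namespace CardSubset

/-- The sign of `j` in `σ`. -/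
def sign (σ : Finset (Fin n)) (j : Fin n) : ℤ := (-1) ^ (σ.filter (fun i => i < j)).card

/-- Deletion of an element. -/
def erase {t : ℕ} (σ : CardSubset n (t + 1)) {j : Fin n} (hj : j ∈ σ.1) : CardSubset n t :=
  ⟨σ.1.erase j, by rw [Finset.card_erase_of_mem hj, σ.2]; rfl⟩

/-- Insertion of an element. -/
def insert {t : ℕ} (σ : CardSubset n t) {j : Fin n} (hj : j ∉ σ.1) : CardSubset n (t + 1) :=
  ⟨Insert.insert j σ.1, by rw [Finset.card_insert_of_notMem hj, σ.2]⟩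

theorem mem_insert {t : ℕ} {σ : CardSubset n t} {i j : Fin n} (hj : j ∉ σ.1) :
    i ∈ (insert σ hj).1 ↔ i = j ∨ i ∈ σ.1 :=
  Finset.mem_insert

/-- The boundary of a simplex. -/
noncomputable def boundary (t : ℕ) : (CardSubset n (t + 1) →₀ ℤ) →ₗ[ℤ] (CardSubset n t →₀ ℤ) :=
  linearCombination ℤ fun σ => ∑ j : Fin n,
    if hj : j ∈ σ.1 then sign σ.1 j • single (erase σ hj) 1 else 0

theorem boundary_single {t : ℕ} (σ : CardSubset n (t + 1)) :
    boundary t (single σ 1) = ∑ j : Fin n,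
      if hj : j ∈ σ.1 then sign σ.1 j • single (erase σ hj) 1 else 0 := by
  rw [boundary, linearCombination_single, one_smul]

/-- The cone with apex the vertex `j`. -/
noncomputable def vertexCone (j : Fin n) (t : ℕ) :
    (CardSubset n t →₀ ℤ) →ₗ[ℤ] (CardSubset n (t + 1) →₀ ℤ) :=
  linearCombination ℤ fun σ => if hj : j ∈ σ.1 then 0 else single (insert σ hj) 1

theorem vertexCone_single_of_mem {j : Fin n} {t : ℕ} {σ : CardSubset n t} (hj : j ∈ σ.1) :
    vertexCone j t (single σ 1) = 0 := by
  rw [vertexCone, linearCombination_single, one_smul, dif_pos hj]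

theorem vertexCone_single_of_notMem {j : Fin n} {t : ℕ} {σ : CardSubset n t} (hj : j ∉ σ.1) :
    vertexCone j t (single σ 1) = single (insert σ hj) 1 := by
  rw [vertexCone, linearCombination_single, one_smul, dif_neg hj]

theorem sign_eq_one {σ : Finset (Fin n)} {j : Fin n} (h : ∀ i ∈ σ, j ≤ i) : sign σ j = 1 := by
  rw [sign, Finset.filter_false_of_mem fun i hi => (h i hi).not_gt, Finset.card_empty, pow_zero]

theorem sign_insert {σ : Finset (Fin n)} {i j : Fin n} (hj : j ∉ σ) (hij : j < i) :
    sign (Insert.insert j σ) i = -sign σ i := by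
  rw [sign, Finset.filter_insert, if_pos hij, Finset.card_insert_of_notMem (by simp [hj]), pow_succ,
    sign, mul_neg_one]

theorem boundary_vertexCone_single {j : Fin n} {t : ℕ} (σ : CardSubset n (t + 1))
    (h : ∀ i ∈ σ.1, j ≤ i) :
    boundary (t + 1) (vertexCone j (t + 1) (single σ 1)) +
      vertexCone j t (boundary t (single σ 1)) = single σ 1 := by
  by_cases hj : j ∈ σ.1
  · rw [vertexCone_single_of_mem hj, map_zero, zero_add, boundary_single, map_sum,
      Finset.sum_eq_single j, dif_pos hj, sign_eq_one h, one_smul,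
      vertexCone_single_of_notMem (by simp [erase])]
    · congr 1
      exact Subtype.ext (Finset.insert_erase hj)
    · intro i _ hij
      split_ifs with hi
      · rw [map_smul, vertexCone_single_of_mem (Finset.mem_erase.2 ⟨hij.symm, hj⟩), smul_zero]
      · exact map_zero _
    · exact fun h => absurd (Finset.mem_univ j) h
  · rw [vertexCone_single_of_notMem hj, boundary_single, boundary_single, map_sum,
      ← Finset.sum_add_distrib, Finset.sum_eq_single j]
    · rw [dif_pos ((mem_insert hj).2 (Or.inl rfl)), dif_neg hj, map_zero, add_zero, sign_eq_one,
        one_smul]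
      · congr 1
        exact Subtype.ext (Finset.erase_insert hj)
      · exact fun i hi => (Finset.mem_insert.1 hi).elim (fun h => h.ge) (h i)
    · intro i _ hij
      by_cases hi : i ∈ σ.1
      · have hji : j ∉ (erase σ hi).1 := fun h => hj (Finset.mem_of_mem_erase h)
        have hs : sign (insert σ hj).1 i = -sign σ.1 i :=
          sign_insert hj ((h i hi).lt_of_ne hij.symm)
        rw [dif_pos hi, dif_pos ((mem_insert hj).2 (Or.inr hi)), map_smul,
          vertexCone_single_of_notMem hji, hs, neg_smul, neg_add_eq_zero]
        congr 2
        exact Subtype.ext (Finset.erase_insert_of_ne hij.symm)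
      · rw [dif_neg hi, dif_neg (by simp [mem_insert, hi, hij]), map_zero, add_zero]
    · exact fun h => absurd (Finset.mem_univ j) h

/-- The cone with apex the least element of `σ`. -/
noncomputable def cone (σ : Finset (Fin n)) (t : ℕ) :
    (CardSubset n t →₀ ℤ) →ₗ[ℤ] (CardSubset n (t + 1) →₀ ℤ) :=
  if hσ : σ.Nonempty then vertexCone (σ.min' hσ) t else 0

theorem cone_of_nonempty {σ : Finset (Fin n)} (hσ : σ.Nonempty) (t : ℕ) :
    cone σ t = vertexCone (σ.min' hσ) t := dif_pos hσ

theorem nonempty {t : ℕ} (σ : CardSubset n (t + 1)) : σ.1.Nonempty :=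
  Finset.card_pos.1 (by rw [σ.2]; exact t.succ_pos)

end CardSubset

/-- The augmented chain complex of the simplex with vertices `{1, …, n}`. -/
noncomputable def simplexComplex (n : ℕ) : ConicalComplex (Finset (Fin n)) where
  X := CardSubset n
  label σ := σ.1
  pt := ⟨∅, Finset.card_empty⟩
  eq_pt σ := Subtype.ext (Finset.card_eq_zero.1 σ.2)
  label_pt := rfl
  label_ne_bot σ := σ.nonempty.ne_empty
  d := CardSubset.boundary
  cone := CardSubset.cone
  d_single_mem σ := by
    rw [CardSubset.boundary_single]
    refine Submodule.sum_mem _ fun j _ => ?_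
    split_ifs with hj
    · exact Submodule.smul_mem _ _ (single_mem_supported ℤ _ (Finset.erase_subset j σ.1))
    · exact Submodule.zero_mem _
  cone_single_mem {σ t} τ hσ h := by
    have hσ := Finset.nonempty_iff_ne_empty.2 hσ
    rw [CardSubset.cone_of_nonempty hσ]
    by_cases hj : σ.min' hσ ∈ τ.1
    · rw [CardSubset.vertexCone_single_of_mem hj]
      exact Submodule.zero_mem _
    · rw [CardSubset.vertexCone_single_of_notMem hj]
      exact single_mem_supported ℤ _ (Finset.insert_subset (σ.min'_mem hσ) h)
  d_cone_pt {σ} hσ := by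
    have hσ := Finset.nonempty_iff_ne_empty.2 hσ
    rw [CardSubset.cone_of_nonempty hσ,
      CardSubset.vertexCone_single_of_notMem (Finset.notMem_empty _), CardSubset.boundary_single,
      Finset.sum_eq_single (σ.min' hσ), dif_pos ((CardSubset.mem_insert _).2 (Or.inl rfl)),
      CardSubset.sign_eq_one (by simp [CardSubset.insert]), one_smul]
    · congr 1
      exact Subtype.ext (Finset.erase_insert (Finset.notMem_empty _))
    · exact fun i _ hi => dif_neg (by simp [CardSubset.insert, hi])
    · exact fun h => absurd (Finset.mem_univ _) h
  d_cone_single {σ t} τ h := by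
    have hσ : σ.Nonempty := τ.nonempty.mono h
    rw [CardSubset.cone_of_nonempty hσ, CardSubset.cone_of_nonempty hσ]
    exact CardSubset.boundary_vertexCone_single τ fun i hi => σ.min'_le i (h hi)
  cone_label_self τ := by
    rw [CardSubset.cone_of_nonempty τ.nonempty]
    exact CardSubset.vertexCone_single_of_mem (Finset.min'_mem _ _)

variable {R : Type} [CommRing R] (M : Type) [AddCommGroup M] [Module R M]

theorem locMapOfDvd_comp_mkLinearMap {a b : R} (h : a ∣ b) :
    locMapOfDvd M h ∘ₗ LocalizedModule.mkLinearMap (Submonoid.powers a) M =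
      LocalizedModule.mkLinearMap (Submonoid.powers b) M :=
  LocalizedModule.lift_comp _ _ _

theorem locMapOfDvd_self {a : R} (h : a ∣ a) : locMapOfDvd M h = LinearMap.id :=
  LocalizedModule.lift_unique _ _ _ _ (LinearMap.id_comp _)

theorem locMapOfDvd_comp {a b c : R} (hab : a ∣ b) (hbc : b ∣ c) :
    locMapOfDvd M hbc ∘ₗ locMapOfDvd M hab = locMapOfDvd M (hab.trans hbc) := by
  refine (LocalizedModule.lift_unique _ _ _ _ ?_).symm
  rw [LinearMap.comp_assoc, locMapOfDvd_comp_mkLinearMap, locMapOfDvd_comp_mkLinearMap]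

variable (x : Fin n → R)

/-- The localization map `M[1/x_σ] → M[1/x_τ]` for `σ ⊆ τ`. -/
noncomputable def locMap ⦃σ τ : Finset (Fin n)⦄ (h : σ ≤ τ) :
    LocalizedModule (Submonoid.powers (xProd x σ)) M →ₗ[R]
      LocalizedModule (Submonoid.powers (xProd x τ)) M :=
  locMapOfDvd M (Finset.prod_dvd_prod_of_subset _ _ _ h)

theorem pcubeAdelicCoboundary_apply {s : ℕ} (f : PCubeAdelicCochain M x s)
    (c : DecChain n (s + 2)) :
    pcubeAdelicCoboundary M x s f c =
      ∑ i : Fin (s + 2), (-1 : ℤ) ^ (i : ℕ) • locMap M x (c.top_face_le i) (f (c.face i)) := by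
  refine (LinearMap.sum_apply _ _ f).trans ?_
  rfl

theorem cechD_apply {t : ℕ} (f : CechObj M x t) (τ : CardSubset n (t + 2)) :
    cechD M x t f τ =
      ∑ j ∈ τ.1.attach, CardSubset.sign τ.1 j.1 •
        locMap M x (Finset.erase_subset j.1 τ.1) (f (τ.erase j.2)) := by
  refine (LinearMap.sum_apply _ _ f).trans ?_
  rfl

theorem coboundary_flagComplex (s : ℕ) :
    (flagComplex n).coboundary (locMap M x) s = pcubeAdelicCoboundary M x s := by
  refine LinearMap.ext fun (f : PCubeAdelicCochain M x s) =>
    funext fun (c : DecChain n (s + 2)) => ?_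
  have h : (flagComplex n).coboundary (locMap M x) s f c =
      evalChain (locMap M x) DecChain.top c.top f (DecChain.boundary (s + 1) (single c 1)) := rfl
  refine (h.trans ?_).trans (pcubeAdelicCoboundary_apply M x f c).symm
  rw [DecChain.boundary_single, map_sum]
  refine Finset.sum_congr rfl fun i _ => ?_
  rw [map_smul]
  exact congrArg _ (evalChain_single (locMap M x) DecChain.top f (c.top_face_le i))

theorem coboundary_simplexComplex (t : ℕ) :
    (simplexComplex n).coboundary (locMap M x) t = cechD M x t := by
  refine LinearMap.ext fun (f : CechObj M x t) => funext fun (τ : CardSubset n (t + 2)) => ?_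
  have h : (simplexComplex n).coboundary (locMap M x) t f τ =
      evalChain (locMap M x) Subtype.val τ.1 f (CardSubset.boundary (t + 1) (single τ 1)) := rfl
  refine (h.trans ?_).trans (cechD_apply M x f τ).symm
  rw [CardSubset.boundary_single, map_sum, ← Finset.sum_subset τ.1.subset_univ, ← Finset.sum_attach]
  · refine Finset.sum_congr rfl fun j _ => ?_
    rw [dif_pos j.2, map_smul]
    exact congrArg _ (evalChain_single (locMap M x) Subtype.val f (a := τ.erase j.2)
      (Finset.erase_subset _ _))
  · intro j _ hj
    rw [dif_neg hj, map_zero]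

end PuncturedCube

/-- the cohomology of the adelic cochain complex on the punctured cube
of nonempty subsets of `{1, …, n}` (with coefficients `M[1/x_{σ₀}]` on chains) is
isomorphic to the Čech cohomology `Č^*_{(x₁,…,xₙ)}(R; M)`, the cohomology of
`0 → ⊕ᵢ M[1/xᵢ] → ⊕_{i<j} M[1/xᵢxⱼ] → ⋯ → M[1/x₁⋯xₙ] → 0` in degrees `0` to `n-1`. -/
theorem punctured_cube_adelic_eq_cech_cohomology
    {R : Type} [CommRing R] (M : Type) [AddCommGroup M] [Module R M]
    {n : ℕ} (x : Fin n → R) :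
    Nonempty
      (LinearMap.ker (pcubeAdelicCoboundary M x 0) ≃ₗ[R] LinearMap.ker (cechD M x 0)) ∧
    ∀ s : ℕ,
      Nonempty
        ((LinearMap.ker (pcubeAdelicCoboundary M x (s + 1)) ⧸
            Submodule.comap (LinearMap.ker (pcubeAdelicCoboundary M x (s + 1))).subtype
              (LinearMap.range (pcubeAdelicCoboundary M x s))) ≃ₗ[R]
          (LinearMap.ker (cechD M x (s + 1)) ⧸
            Submodule.comap (LinearMap.ker (cechD M x (s + 1))).subtype
              (LinearMap.range (cechD M x s)))) :=
  ConicalComplex.nonempty_cohomology_equiv (locMap M x)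
    (fun _ => locMapOfDvd_self M _) (fun _ _ _ _ _ => locMapOfDvd_comp M _ _)
    (flagComplex n) (simplexComplex n)
    (funext (coboundary_flagComplex M x)) (funext (coboundary_simplexComplex M x))
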